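/- For every integer k ≥ 2, every linear k-graph with the weak Erdős–Szekeres property has more than (k−1)·(k−1)!/(2e·k) vertices; that is, n'_wES(k) ≥ (k−1)·(k−1)!/(2e·k). -/

import Mathlib

open scoped Classical

namespace WES

/-- `f` is weakly monotone or weakly antitone on `e` with respect to `σ`. -/
def Bad {V : Type*} {M : ℕ} (σ : V → ℕ) (e : Finset V) (f : V → Fin M) : Prop :=
  (∀ x ∈ e, ∀ y ∈ e, σ x < σ y → f x ≤ f y) ∨ (∀ x ∈ e, ∀ y ∈ e, σ x < σ y → f y ≤ f x)

/-- functions with no bad edge inside `S`. -/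
noncomputable def Good {V : Type*} [Fintype V] (M : ℕ) (σ : V → ℕ) (E : Finset (Finset V))
    (S : Finset V) : Finset (V → Fin M) :=
  Finset.univ.filter fun f => ∀ e ∈ E, e ⊆ S → ¬ Bad σ e f

lemma Bad.congr {V : Type*} {M : ℕ} {σ : V → ℕ} {e : Finset V} {f g : V → Fin M}
    (h : ∀ x ∈ e, f x = g x) (hf : Bad σ e f) : Bad σ e g := by
  rcases hf with hf | hf
  · left
    intro x hx y hy hxy
    rw [← h x hx, ← h y hy]
    exact hf x hx y hy hxy
  · right
    intro x hx y hy hxy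
    rw [← h x hx, ← h y hy]
    exact hf x hx y hy hxy

lemma exists_list {V : Type*} (σ : V → ℕ) (hσ : Function.Injective σ) (e : Finset V) :
    ∃ l : List V, (l : Multiset V) = e.val ∧ l.Pairwise (fun x y => σ x < σ y) := by
  let l := e.toList.mergeSort (fun x y => decide (σ x ≤ σ y))
  have hp : l.Perm e.toList := List.mergeSort_perm _ _
  have hs : l.Pairwise (fun x y => decide (σ x ≤ σ y) = true) := by
    apply List.pairwise_mergeSort
    · intro a b c; simp; omega
    · intro a b; simp; omega
  have hn : l.Nodup := hp.nodup_iff.2 e.nodup_toList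
  refine ⟨l, ?_, ?_⟩
  · rw [Multiset.coe_eq_coe.2 hp]; simp
  · have := hs.and hn
    refine this.imp ?_
    rintro a b ⟨h1, h2⟩
    have h1 : σ a ≤ σ b := by simpa using h1
    exact lt_of_le_of_ne h1 (fun h => h2 (hσ h))

lemma mono_unique {V : Type*} {M : ℕ} {σ : V → ℕ} (hσ : Function.Injective σ) {e : Finset V}
    {f g : V → Fin M} (r : Fin M → Fin M → Prop) [Std.Antisymm r]
    (hf : ∀ x ∈ e, ∀ y ∈ e, σ x < σ y → r (f x) (f y))
    (hg : ∀ x ∈ e, ∀ y ∈ e, σ x < σ y → r (g x) (g y))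
    (h : e.val.map f = e.val.map g) : ∀ x ∈ e, f x = g x := by
  obtain ⟨l, hl, hs⟩ := exists_list σ hσ e
  have hmem : ∀ x, x ∈ l ↔ x ∈ e := by
    intro x
    rw [← Finset.mem_val, ← hl]; simp
  rw [← hl] at h
  simp only [Multiset.map_coe, Multiset.coe_eq_coe] at h
  have h1 : ∀ {f : V → Fin M}, (∀ x ∈ e, ∀ y ∈ e, σ x < σ y → r (f x) (f y)) →
      (l.map f).Pairwise r := by
    intro f hf
    rw [List.pairwise_map]
    refine List.Pairwise.imp_of_mem ?_ hs
    intro a b ha hb hab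
    exact hf a ((hmem a).1 ha) b ((hmem b).1 hb) hab
  have h2 := h.eq_of_pairwise (fun a b _ _ h1 h2 => antisymm_of r h1 h2) (h1 hf) (h1 hg)
  intro x hx
  exact List.map_inj_left.1 h2 x ((hmem x).2 hx)

lemma indep {V : Type*} [Fintype V] {M k : ℕ} {σ : V → ℕ} (hσ : Function.Injective σ)
    (E : Finset (Finset V)) (e : Finset V) (he : e.card = k) (S : Finset V) :
    ((Good M σ E (S \ e)).filter (Bad σ e)).card * M ^ k ≤
      (Good M σ E (S \ e)).card * (2 * M.multichoose k) := by
  have hc1 : M ^ k = (Finset.univ : Finset (e → Fin M)).card := by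
    simp [he]
  have hc2 : 2 * M.multichoose k = (Finset.univ : Finset (Bool × Sym (Fin M) k)).card := by
    rw [Finset.card_univ, Fintype.card_prod, Sym.card_sym_eq_multichoose]; simp
  rw [hc1, hc2, ← Finset.card_product, ← Finset.card_product]
  let φ : (V → Fin M) × (e → Fin M) → (V → Fin M) × (Bool × Sym (Fin M) k) := fun p =>
    (fun x => if h : x ∈ e then p.2 ⟨x, h⟩ else p.1 x,
      (decide (∀ x ∈ e, ∀ y ∈ e, σ x < σ y → p.1 x ≤ p.1 y), ⟨e.val.map p.1, by simp [he]⟩))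
  apply Finset.card_le_card_of_injOn φ
  · rintro ⟨f, g⟩ hp
    simp only [Finset.coe_product, Set.mem_prod, Finset.mem_coe, Finset.mem_filter, Good,
      Finset.mem_univ, true_and, and_true] at hp ⊢
    intro e' he' hsub hb
    refine hp.1 e' he' hsub (hb.congr ?_)
    intro x hx
    have := Finset.mem_sdiff.1 (hsub hx)
    simp [φ, this.2]
  · rintro ⟨f, g⟩ hp ⟨f', g'⟩ hp' heq
    simp only [Finset.coe_product, Set.mem_prod, Finset.mem_coe, Finset.mem_filter] at hp hp'
    have h1 := congrArg Prod.fst heq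
    have h2 := decide_eq_decide.1 (congrArg (fun q => q.2.1) heq)
    have h3 : e.val.map f = e.val.map f' := congrArg (fun q => q.2.2.1) heq
    simp only [φ] at h1 h2
    have hon : ∀ x ∈ e, f x = f' x := by
      by_cases hm : ∀ x ∈ e, ∀ y ∈ e, σ x < σ y → f x ≤ f y
      · exact mono_unique hσ (· ≤ ·) hm (h2.1 hm) h3
      · have a1 := hp.1.2.resolve_left hm
        have a2 := hp'.1.2.resolve_left (fun h => hm (h2.2 h))
        exact mono_unique hσ (· ≥ ·) a1 a2 h3
    refine Prod.ext ?_ ?_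
    · funext x
      by_cases hx : x ∈ e
      · exact hon x hx
      · simpa [hx] using congrFun h1 x
    · funext ⟨x, hx⟩
      simpa [hx] using congrFun h1 x

lemma chain {V : Type*} (c : Finset V → ℝ) (β : ℝ) (hβ : 0 ≤ β) (S : Finset V)
    (h : ∀ S', S' ⊂ S → ∀ v ∉ S', β * c S' ≤ c (insert v S')) (T U : Finset V)
    (hd : Disjoint T U) (hs : T ∪ U ⊆ S) : β ^ U.card * c T ≤ c (T ∪ U) := by
  induction U using Finset.induction_on with
  | empty => simp
  | insert u U hu ih =>
    rw [Finset.disjoint_insert_right] at hd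
    have hsub : T ∪ U ⊆ S := by
      refine subset_trans ?_ hs
      exact Finset.union_subset_union_right (Finset.subset_insert _ _)
    have h1 := ih hd.2 hsub
    have hn : u ∉ T ∪ U := by simp [hd.1, hu]
    have hss : T ∪ U ⊂ S := by
      refine (Finset.ssubset_iff_of_subset hsub).2 ⟨u, hs (by simp), hn⟩
    have h2 := h _ hss u hn
    rw [Finset.union_insert, Finset.card_insert_of_notMem hu, pow_succ]
    calc β ^ U.card * β * c T = β * (β ^ U.card * c T) := by ring
      _ ≤ β * c (T ∪ U) := by gcongr
      _ ≤ _ := h2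

lemma step {V : Type*} [Fintype V] {M k : ℕ} (hM : 0 < M) (σ : V → ℕ)
    (hσ : Function.Injective σ) (E : Finset (Finset V)) (hcard : ∀ e ∈ E, e.card = k)
    (β p d : ℝ) (hβ : 0 < β) (hβ1 : β ≤ 1) (hp : 2 * (M.multichoose k : ℝ) ≤ p * M ^ k)
    (hp0 : 0 ≤ p)
    (hd : ∀ v, ((E.filter (v ∈ ·)).card : ℝ) ≤ d) (hmain : d * p ≤ (1 - β) * β ^ (k - 1))
    (S : Finset V) : ∀ v ∉ S, β * ((Good M σ E S).card : ℝ) ≤ (Good M σ E (insert v S)).card := by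
  induction S using Finset.strongInduction with
  | H S ih =>
  intro v hv
  have hMk : (0 : ℝ) < (M : ℝ) ^ k := by positivity
  have hsub : Good M σ E S ⊆ Good M σ E (insert v S) ∪
      ((E.filter (v ∈ ·)).filter (· ⊆ insert v S)).biUnion
        (fun e => (Good M σ E (S \ e)).filter (Bad σ e)) := by
    intro f hf
    by_cases hg : f ∈ Good M σ E (insert v S)
    · exact Finset.mem_union_left _ hg
    · apply Finset.mem_union_right
      simp only [Good, Finset.mem_filter, Finset.mem_univ, true_and, not_forall, not_not] at hf hg
      obtain ⟨e, he, hes, hb⟩ := hg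
      rw [Finset.mem_biUnion]
      refine ⟨e, ?_, ?_⟩
      · simp only [Finset.mem_filter]
        refine ⟨⟨he, ?_⟩, hes⟩
        by_contra hve
        exact hf e he ((Finset.subset_insert_iff_of_notMem hve).1 hes) hb
      · simp only [Good, Finset.mem_filter, Finset.mem_univ, true_and]
        exact ⟨fun e' he' hs' => hf e' he' (hs'.trans Finset.sdiff_subset), hb⟩
  have hc := (Finset.card_le_card hsub).trans (Finset.card_union_le _ _)
  have hbound : ∀ e ∈ (E.filter (v ∈ ·)).filter (· ⊆ insert v S),
      (((Good M σ E (S \ e)).filter (Bad σ e)).card : ℝ) ≤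
        p * ((Good M σ E S).card / β ^ (k - 1)) := by
    intro e he
    simp only [Finset.mem_filter] at he
    obtain ⟨⟨he, hve⟩, hes⟩ := he
    have h1 : (((Good M σ E (S \ e)).filter (Bad σ e)).card : ℝ) * M ^ k ≤
        (Good M σ E (S \ e)).card * (2 * M.multichoose k) := by
      exact_mod_cast indep hσ E e (hcard e he) S
    have h2 : (((Good M σ E (S \ e)).filter (Bad σ e)).card : ℝ) ≤
        p * (Good M σ E (S \ e)).card := by
      refine le_of_mul_le_mul_right ?_ hMk
      calc _ ≤ _ := h1
        _ ≤ (Good M σ E (S \ e)).card * (p * M ^ k) := by gcongr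
        _ = _ := by ring
    have hun : S \ e ∪ S ∩ e = S := Finset.sdiff_union_inter S e
    have h3 := chain (fun S => ((Good M σ E S).card : ℝ)) β hβ.le S ih (S \ e) (S ∩ e)
      (Finset.disjoint_sdiff_inter S e) (by rw [hun])
    simp only [hun] at h3
    have h4 : (S ∩ e).card ≤ k - 1 := by
      rw [← hcard e he, ← Finset.card_erase_of_mem hve]
      apply Finset.card_le_card
      intro x hx
      rw [Finset.mem_inter] at hx
      exact Finset.mem_erase.2 ⟨fun h => hv (h ▸ hx.1), hx.2⟩
    have h5 : β ^ (k - 1) ≤ β ^ (S ∩ e).card := pow_le_pow_of_le_one hβ.le hβ1 h4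
    refine h2.trans ?_
    gcongr
    rw [le_div_iff₀ (by positivity), mul_comm]
    refine le_trans ?_ h3
    gcongr
  have hc' : ((Good M σ E S).card : ℝ) ≤ (Good M σ E (insert v S)).card +
      d * (p * ((Good M σ E S).card / β ^ (k - 1))) := by
    have hb : ((((E.filter (v ∈ ·)).filter (· ⊆ insert v S)).biUnion
        (fun e => (Good M σ E (S \ e)).filter (Bad σ e))).card : ℝ) ≤
        d * (p * ((Good M σ E S).card / β ^ (k - 1))) := by
      calc _ ≤ ((∑ e ∈ (E.filter (v ∈ ·)).filter (· ⊆ insert v S),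
            ((Good M σ E (S \ e)).filter (Bad σ e)).card : ℕ) : ℝ) := by
              exact_mod_cast Finset.card_biUnion_le
        _ ≤ ∑ e ∈ (E.filter (v ∈ ·)).filter (· ⊆ insert v S),
            p * ((Good M σ E S).card / β ^ (k - 1)) := by
              rw [Nat.cast_sum]
              exact Finset.sum_le_sum hbound
        _ = ((E.filter (v ∈ ·)).filter (· ⊆ insert v S)).card *
            (p * ((Good M σ E S).card / β ^ (k - 1))) := by simp
        _ ≤ _ := by
              gcongr
              refine le_trans ?_ (hd v)
              exact_mod_cast Finset.card_filter_le _ _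
    have hc2 : ((Good M σ E S).card : ℝ) ≤ (Good M σ E (insert v S)).card +
      ((((E.filter (v ∈ ·)).filter (· ⊆ insert v S)).biUnion
        (fun e => (Good M σ E (S \ e)).filter (Bad σ e))).card : ℝ) := by exact_mod_cast hc
    linarith
  have hfin : d * (p * ((Good M σ E S).card / β ^ (k - 1))) ≤ (1 - β) * (Good M σ E S).card := by
    have hpos : 0 < β ^ (k - 1) := by positivity
    rw [show d * (p * (((Good M σ E S).card : ℝ) / β ^ (k - 1))) =
      (d * p) * (Good M σ E S).card / β ^ (k - 1) by ring, div_le_iff₀ hpos]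
    calc _ ≤ ((1 - β) * β ^ (k - 1)) * ((Good M σ E S).card : ℝ) := by gcongr
      _ = _ := by ring
  linarith

lemma degree {V : Type*} [Fintype V] (k : ℕ) (E : Finset (Finset V))
    (hcard : ∀ e ∈ E, e.card = k)
    (hlin : ∀ e ∈ E, ∀ f ∈ E, e ≠ f → (e ∩ f).card ≤ 1) (v : V) :
    (E.filter (v ∈ ·)).card * (k - 1) ≤ Fintype.card V := by
  have h : ((E.filter (v ∈ ·)).biUnion (fun e => e.erase v)).card =
      ∑ e ∈ E.filter (v ∈ ·), (e.erase v).card := by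
    apply Finset.card_biUnion
    intro e he f hf hne
    have he := Finset.mem_filter.1 he
    have hf := Finset.mem_filter.1 hf
    rw [Function.onFun, Finset.disjoint_left]
    intro x hx hx'
    rw [Finset.mem_erase] at hx hx'
    have := Finset.card_le_one.1 (hlin e he.1 f hf.1 hne) x (by simp [hx.2, hx'.2]) v
      (by simp [he.2, hf.2])
    exact hx.1 this
  have h2 : ∑ e ∈ E.filter (v ∈ ·), (e.erase v).card = (E.filter (v ∈ ·)).card * (k - 1) := by
    rw [Finset.sum_const_nat]
    intro e he
    simp only [Finset.mem_filter] at he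
    rw [Finset.card_erase_of_mem he.2, hcard e he.1]
  rw [← h2, ← h]
  exact Finset.card_le_univ _

lemma multichoose_bound (k : ℕ) (hk : 2 ≤ k) :
    2 * (((2 * k ^ 2).multichoose k : ℕ) : ℝ) ≤
      (4 / (Nat.factorial k : ℝ)) * ((2 * k ^ 2 : ℕ) : ℝ) ^ k := by
  have hk0 : (0 : ℝ) < k := by positivity
  have h1 : (((2 * k ^ 2).multichoose k : ℕ) : ℝ) ≤
      ((2 * k ^ 2 + k - 1 : ℕ) : ℝ) ^ k / (Nat.factorial k : ℝ) := by
    rw [Nat.multichoose_eq]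
    exact Nat.choose_le_pow_div k _
  have h2 : ((2 * k ^ 2 + k - 1 : ℕ) : ℝ) ≤ ((2 * k ^ 2 : ℕ) : ℝ) * (1 / (2 * k) + 1) := by
    have : ((2 * k ^ 2 + k - 1 : ℕ) : ℝ) ≤ ((2 * k ^ 2 + k : ℕ) : ℝ) := by
      exact_mod_cast Nat.sub_le _ _
    refine this.trans (le_of_eq ?_)
    push_cast
    field_simp
    ring
  have h3 : (1 / (2 * (k : ℝ)) + 1) ^ k ≤ 2 := by
    calc (1 / (2 * (k : ℝ)) + 1) ^ k ≤ (Real.exp (1 / (2 * (k : ℝ)))) ^ k := by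
          gcongr
          exact Real.add_one_le_exp _
      _ = Real.exp (1 / 2) := by
          rw [← Real.exp_nat_mul]
          congr 1
          field_simp
      _ ≤ 2 := by
          have h : Real.exp (1 / 2) ^ 2 = Real.exp 1 := by
            rw [← Real.exp_nat_mul]; norm_num
          have := Real.exp_one_lt_d9
          have := Real.exp_pos (1 / 2)
          nlinarith
  have h4 : ((2 * k ^ 2 + k - 1 : ℕ) : ℝ) ^ k ≤ ((2 * k ^ 2 : ℕ) : ℝ) ^ k * 2 := by
    calc _ ≤ (((2 * k ^ 2 : ℕ) : ℝ) * (1 / (2 * k) + 1)) ^ k := by gcongr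
      _ = ((2 * k ^ 2 : ℕ) : ℝ) ^ k * (1 / (2 * k) + 1) ^ k := by rw [mul_pow]
      _ ≤ _ := by gcongr
  calc _ ≤ 2 * (((2 * k ^ 2 + k - 1 : ℕ) : ℝ) ^ k / (Nat.factorial k : ℝ)) := by gcongr
    _ ≤ 2 * (((2 * k ^ 2 : ℕ) : ℝ) ^ k * 2 / (Nat.factorial k : ℝ)) := by gcongr
    _ = _ := by ring

lemma beta_bound (k : ℕ) (hk : 2 ≤ k) :
    1 / Real.exp 1 ≤ (1 - 1 / (k : ℝ)) ^ (k - 1) := by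
  obtain ⟨m, rfl⟩ : ∃ m, k = m + 1 := ⟨k - 1, by omega⟩
  have hm : (0 : ℝ) < m := by
    have : 0 < m := by omega
    exact_mod_cast this
  have h1 : (1 / (m : ℝ) + 1) ^ m ≤ Real.exp 1 := by
    calc (1 / (m : ℝ) + 1) ^ m ≤ (Real.exp (1 / (m : ℝ))) ^ m := by
          gcongr
          exact Real.add_one_le_exp _
      _ = Real.exp 1 := by
          rw [← Real.exp_nat_mul]
          congr 1
          field_simp
  have h2 : (1 - 1 / ((m + 1 : ℕ) : ℝ)) = (1 / (m : ℝ) + 1)⁻¹ := by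
    push_cast
    field_simp
    ring
  rw [h2, Nat.add_sub_cancel, inv_pow, one_div]
  gcongr

end WES

/-- For every integer `k ≥ 2`, every linear `k`-graph with the weak
Erdős–Szekeres property has more than `(k−1)·(k−1)!/(2e·k)` vertices; that is,
`n'_wES(k) ≥ (k−1)·(k−1)!/(2e·k)`. -/
theorem stmt_8 (k : ℕ) (hk : 2 ≤ k) (V : Type*) [Fintype V]
    (E : Finset (Finset V))
    (hcard : ∀ e ∈ E, e.card = k)
    (hlin : ∀ e ∈ E, ∀ f ∈ E, e ≠ f → (e ∩ f).card ≤ 1)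
    (hwES : ∃ σ : V → ℕ, Function.Injective σ ∧
      ∀ τ : V → ℕ, Function.Injective τ →
        ∃ e ∈ E, (∀ x ∈ e, ∀ y ∈ e, σ x < σ y → τ x < τ y) ∨
                 (∀ x ∈ e, ∀ y ∈ e, σ x < σ y → τ y < τ x)) :
    ((k : ℝ) - 1) * (Nat.factorial (k - 1) : ℝ) / (2 * Real.exp 1 * (k : ℝ)) <
      (Fintype.card V : ℝ) := by
  by_contra hcon
  push Not at hcon
  obtain ⟨σ, hσ, hall⟩ := hwES
  have hk0 : (0 : ℝ) < k := by positivity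
  have hk2 : (2 : ℝ) ≤ k := by exact_mod_cast hk
  have hk1 : (0 : ℝ) < (k : ℝ) - 1 := by linarith
  have hcast : ((k - 1 : ℕ) : ℝ) = (k : ℝ) - 1 := by
    rw [Nat.cast_sub (by omega)]; simp
  have he := Real.exp_pos 1
  have hfac : (Nat.factorial k : ℝ) = k * (Nat.factorial (k - 1) : ℝ) := by
    exact_mod_cast (Nat.mul_factorial_pred (by omega)).symm
  have hfpos : (0 : ℝ) < (Nat.factorial (k - 1) : ℝ) := by exact_mod_cast Nat.factorial_pos _
  have hM : 0 < 2 * k ^ 2 := by positivity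
  have hβ : 0 < 1 - 1 / (k : ℝ) := by
    rw [sub_pos, div_lt_one hk0]; linarith
  have hβ1 : 1 - 1 / (k : ℝ) ≤ 1 := by
    have : 0 < 1 / (k : ℝ) := by positivity
    linarith
  have hstep := WES.step hM σ hσ E hcard (1 - 1 / (k : ℝ)) (4 / (Nat.factorial k : ℝ))
    ((Nat.factorial (k - 1) : ℝ) / (2 * Real.exp 1 * k)) hβ hβ1
    (WES.multichoose_bound k hk) (by positivity)
    (by
      intro v
      have h := WES.degree k E hcard hlin v
      have h' : ((E.filter (v ∈ ·)).card : ℝ) * ((k : ℝ) - 1) ≤ Fintype.card V := by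
        rw [← hcast]; exact_mod_cast h
      refine le_of_mul_le_mul_right ((h'.trans hcon).trans (le_of_eq ?_)) hk1
      ring)
    (by
      refine le_trans ?_ (mul_le_mul_of_nonneg_left (WES.beta_bound k hk) (by linarith))
      rw [hfac]
      have : (Nat.factorial (k - 1) : ℝ) / (2 * Real.exp 1 * k) *
        (4 / (k * (Nat.factorial (k - 1) : ℝ))) = (2 / k) * (1 / k * (1 / Real.exp 1)) := by
        field_simp
        norm_num
      rw [this, show (1 - (1 - 1 / (k : ℝ))) = 1 / k by ring]
      have h2 : 2 / (k : ℝ) ≤ 1 := by rw [div_le_one hk0]; exact hk2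
      exact mul_le_of_le_one_left (by positivity) h2)
  have hpos : ∀ S : Finset V, 0 < (WES.Good (2 * k ^ 2) σ E S).card := by
    intro S
    induction S using Finset.induction_on with
    | empty =>
      rw [Finset.card_pos]
      refine ⟨fun _ => ⟨0, hM⟩, ?_⟩
      simp only [WES.Good, Finset.mem_filter, Finset.mem_univ, true_and]
      intro e he' hs
      have h1 := hcard e he'
      rw [Finset.subset_empty.1 hs] at h1
      simp at h1
      omega
    | insert v S hv ih =>
      have h1 := hstep S v hv
      have h2 : (0 : ℝ) < (WES.Good (2 * k ^ 2) σ E S).card := by exact_mod_cast ih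
      have h3 := lt_of_lt_of_le (mul_pos hβ h2) h1
      exact_mod_cast h3
  obtain ⟨f, hf⟩ := Finset.card_pos.1 (hpos Finset.univ)
  simp only [WES.Good, Finset.mem_filter, Finset.mem_univ, true_and] at hf
  obtain ⟨B, hB⟩ : ∃ B, ∀ x, σ x < B :=
    ⟨Finset.univ.sup σ + 1, fun x => Nat.lt_succ_of_le (Finset.le_sup (Finset.mem_univ x))⟩
  have key : ∀ x y, (f x : ℕ) * B + σ x < f y * B + σ y → f x ≤ f y := by
    intro x y h
    by_contra hlt
    have hlt : (f y : ℕ) + 1 ≤ f x := by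
      have := not_le.1 hlt
      exact this
    have := Nat.mul_le_mul_right B hlt
    have := hB y
    rw [Nat.add_mul] at *
    omega
  obtain ⟨e, heE, hmono⟩ := hall (fun x => (f x : ℕ) * B + σ x) (by
    intro x y h
    have h : (f x : ℕ) * B + σ x = f y * B + σ y := h
    apply hσ
    have h' := congrArg (· % B) h
    simpa [Nat.mul_add_mod_self_right, Nat.mod_eq_of_lt (hB _)] using h')
  refine hf e heE (Finset.subset_univ _) ?_
  rcases hmono with h | h
  · exact Or.inl fun x hx y hy hxy => key x y (h x hx y hy hxy)
  · exact Or.inr fun x hx y hy hxy => key y x (h x hx y hy hxy)
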